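/- Let β ∈ (0,1), μ > 0, α ≥ 0, κ₀ ∈ (0,1), and let G : ℝ → ℂ be a measurable function such that ∫_ℝ |λ|^{κ₀−1} |G(λ)|² dλ < ∞ and ∫_ℝ |λ|^{2αη + κ₀ − 1} |G(λ)|² dλ < ∞ for some η ∈ (0,1]. Then there exists C > 0 such that for all t, s > 0, ∫_ℝ |G(λ)|² · |E_β(−μ t^β |λ|^α) − E_β(−μ s^β |λ|^α)|² · |λ|^{κ₀−1} dλ ≤ C |t − s|^{2ηβ}. (This expresses, via the Itô isometry, that the limit field Ũ₀^g(t,x) of Theorem 3.2, with G = ĝ(·,x), is mean-square Hölder continuous in time of any order γ_t ∈ (0, η̃_*β).) -/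

import Mathlib

open Real MeasureTheory

/-- The Mittag-Leffler function `E_β(s) = ∑_{k=0}^∞ s^k / Γ(1 + βk)`. -/
noncomputable def mittagLeffler (β s : ℝ) : ℝ :=
  ∑' k : ℕ, s ^ k / Real.Gamma (1 + β * k)

open Filter Topology

/-- The formal power series `(1 - X) ^ (-a)`. -/
noncomputable def invOneSubRpow (a : ℝ) : PowerSeries ℝ :=
  PowerSeries.rescale (-1) (PowerSeries.binomialSeries ℝ (-a))

lemma invOneSubRpow_add (a b : ℝ) :
    invOneSubRpow (a + b) = invOneSubRpow a * invOneSubRpow b := by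
  rw [invOneSubRpow, neg_add, PowerSeries.binomialSeries_add, map_mul]
  rfl

lemma invOneSubRpow_zero : invOneSubRpow 0 = 1 := by
  simp [invOneSubRpow]

lemma coeff_zero_invOneSubRpow (a : ℝ) : PowerSeries.coeff 0 (invOneSubRpow a) = 1 := by
  simp [invOneSubRpow]

lemma coeff_succ_invOneSubRpow (a : ℝ) (n : ℕ) :
    PowerSeries.coeff (n + 1) (invOneSubRpow a) =
      PowerSeries.coeff n (invOneSubRpow a) * ((a + n) / (n + 1)) := by
  simp only [invOneSubRpow, PowerSeries.coeff_rescale, PowerSeries.binomialSeries_coeff,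
    Ring.choose_eq_smul, descPochhammer_succ_right, Polynomial.smeval_mul, Polynomial.smeval_sub,
    Polynomial.smeval_X, Polynomial.smeval_natCast, Nat.factorial_succ, smul_eq_mul]
  have := Nat.factorial_ne_zero n
  push_cast
  field_simp
  ring

lemma coeff_invOneSubRpow_nonneg {a : ℝ} (ha : 0 ≤ a) (n : ℕ) :
    0 ≤ PowerSeries.coeff n (invOneSubRpow a) := by
  induction n with
  | zero => simp [coeff_zero_invOneSubRpow]
  | succ n ih => rw [coeff_succ_invOneSubRpow]; positivity

lemma coeff_invOneSubRpow_one (n : ℕ) : PowerSeries.coeff n (invOneSubRpow 1) = 1 := by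
  induction n with
  | zero => exact coeff_zero_invOneSubRpow 1
  | succ n ih =>
    rw [coeff_succ_invOneSubRpow, ih]
    have : (n : ℝ) + 1 ≠ 0 := by positivity
    field_simp
    ring

lemma coeff_succ_invOneSubRpow_neg_nonpos {β : ℝ} (h0 : 0 ≤ β) (h1 : β ≤ 1) (n : ℕ) :
    PowerSeries.coeff (n + 1) (invOneSubRpow (-β)) ≤ 0 := by
  induction n with
  | zero => simp [coeff_succ_invOneSubRpow, coeff_zero_invOneSubRpow, h0]
  | succ n ih =>
    rw [coeff_succ_invOneSubRpow]
    refine mul_nonpos_of_nonpos_of_nonneg ih (div_nonneg ?_ (by positivity))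
    push_cast
    have : (0 : ℝ) ≤ n := by positivity
    linarith

lemma PowerSeries.coeff_mul_nonneg {f g : PowerSeries ℝ} (hf : ∀ n, 0 ≤ PowerSeries.coeff n f)
    (hg : ∀ n, 0 ≤ PowerSeries.coeff n g) (n : ℕ) : 0 ≤ PowerSeries.coeff n (f * g) := by
  rw [PowerSeries.coeff_mul]
  exact Finset.sum_nonneg fun p _ => mul_nonneg (hf _) (hg _)

/-- The formal power series `((1 - X) ^ β + y)⁻¹`. -/
noncomputable def fracResolvent (β y : ℝ) : PowerSeries ℝ :=
  (invOneSubRpow (-β) + PowerSeries.C y)⁻¹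

/-- The formal power series `(1 - X) ^ (β - 1) / ((1 - X) ^ β + y)`, the generating function of a
discretization of the Mittag-Leffler function. -/
noncomputable def discreteMittagLeffler (β y : ℝ) : PowerSeries ℝ :=
  invOneSubRpow (1 - β) * fracResolvent β y

section

variable {β y : ℝ}

lemma mul_fracResolvent (hy : 0 ≤ y) :
    (invOneSubRpow (-β) + PowerSeries.C y) * fracResolvent β y = 1 := by
  refine PowerSeries.mul_inv_cancel _ ?_
  have := coeff_zero_invOneSubRpow (-β)
  rw [PowerSeries.coeff_zero_eq_constantCoeff_apply] at this
  rw [map_add, this, PowerSeries.constantCoeff_C]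
  positivity

lemma coeff_fracResolvent_nonneg (h0 : 0 ≤ β) (h1 : β ≤ 1) (hy : 0 ≤ y) (n : ℕ) :
    0 ≤ PowerSeries.coeff n (fracResolvent β y) := by
  induction n using Nat.strong_induction_on with
  | _ n ih =>
    have h := congrArg (PowerSeries.coeff n) (mul_fracResolvent (β := β) hy)
    rw [add_mul, map_add, PowerSeries.coeff_C_mul, PowerSeries.coeff_mul,
      Finset.Nat.sum_antidiagonal_eq_sum_range_succ_mk, Finset.sum_range_succ'] at h
    simp only [coeff_zero_invOneSubRpow, one_mul, Nat.sub_zero] at h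
    have h2 : ∑ k ∈ Finset.range n, PowerSeries.coeff (k + 1) (invOneSubRpow (-β)) *
        PowerSeries.coeff (n - (k + 1)) (fracResolvent β y) ≤ 0 := by
      refine Finset.sum_nonpos fun k hk => ?_
      have hk := Finset.mem_range.1 hk
      exact mul_nonpos_of_nonpos_of_nonneg (coeff_succ_invOneSubRpow_neg_nonpos h0 h1 k)
        (ih _ (by omega))
    have h3 : 0 ≤ PowerSeries.coeff n (1 : PowerSeries ℝ) := by
      rw [PowerSeries.coeff_one]; split_ifs <;> norm_num
    have h4 : 0 ≤ (1 + y) * PowerSeries.coeff n (fracResolvent β y) := by linarith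
    exact nonneg_of_mul_nonneg_right h4 (by positivity)

lemma coeff_discreteMittagLeffler_nonneg (h0 : 0 ≤ β) (h1 : β ≤ 1) (hy : 0 ≤ y) (n : ℕ) :
    0 ≤ PowerSeries.coeff n (discreteMittagLeffler β y) :=
  PowerSeries.coeff_mul_nonneg (coeff_invOneSubRpow_nonneg (by linarith))
    (coeff_fracResolvent_nonneg h0 h1 hy) n

lemma invOneSubRpow_sub_fracResolvent (hy : 0 ≤ y) :
    invOneSubRpow β - fracResolvent β y =
      PowerSeries.C y * (invOneSubRpow β * fracResolvent β y) := by
  have h := mul_fracResolvent (β := β) hy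
  have h2 : invOneSubRpow β * invOneSubRpow (-β) = 1 := by
    rw [← invOneSubRpow_add, add_neg_cancel, invOneSubRpow_zero]
  linear_combination (-invOneSubRpow β) * h + fracResolvent β y * h2

lemma discreteMittagLeffler_eq_sub (hy : 0 ≤ y) :
    discreteMittagLeffler β y =
      invOneSubRpow 1 - PowerSeries.C y * (invOneSubRpow β * discreteMittagLeffler β y) := by
  have h := invOneSubRpow_sub_fracResolvent (β := β) hy
  have h2 : invOneSubRpow 1 = invOneSubRpow (1 - β) * invOneSubRpow β := by
    rw [← invOneSubRpow_add, sub_add_cancel]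
  rw [discreteMittagLeffler, h2]
  linear_combination (-invOneSubRpow (1 - β)) * h

lemma coeff_sub_fracResolvent_nonneg (h0 : 0 ≤ β) (h1 : β ≤ 1) (hy : 0 ≤ y) (n : ℕ) :
    0 ≤ PowerSeries.coeff n (invOneSubRpow β - fracResolvent β y) := by
  rw [invOneSubRpow_sub_fracResolvent hy, PowerSeries.coeff_C_mul]
  exact mul_nonneg hy (PowerSeries.coeff_mul_nonneg (coeff_invOneSubRpow_nonneg h0)
    (coeff_fracResolvent_nonneg h0 h1 hy) n)

lemma coeff_sub_discreteMittagLeffler_nonneg (h0 : 0 ≤ β) (h1 : β ≤ 1) (hy : 0 ≤ y) (n : ℕ) :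
    0 ≤ PowerSeries.coeff n (invOneSubRpow 1 - discreteMittagLeffler β y) := by
  have h : invOneSubRpow 1 - discreteMittagLeffler β y =
      PowerSeries.C y * (invOneSubRpow β * discreteMittagLeffler β y) := by
    linear_combination -discreteMittagLeffler_eq_sub (β := β) hy
  rw [h, PowerSeries.coeff_C_mul]
  exact mul_nonneg hy (PowerSeries.coeff_mul_nonneg (coeff_invOneSubRpow_nonneg h0)
    (coeff_discreteMittagLeffler_nonneg h0 h1 hy) n)

lemma coeff_discreteMittagLeffler_le_one (h0 : 0 ≤ β) (h1 : β ≤ 1) (hy : 0 ≤ y) (n : ℕ) :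
    PowerSeries.coeff n (discreteMittagLeffler β y) ≤ 1 := by
  have h := coeff_sub_discreteMittagLeffler_nonneg h0 h1 hy n
  rw [map_sub, coeff_invOneSubRpow_one] at h
  linarith

lemma abs_coeff_discreteMittagLeffler_sub_le (h0 : 0 ≤ β) (h1 : β ≤ 1) (hy : 0 ≤ y) {z : ℝ}
    (hz : 0 ≤ z) (n : ℕ) :
    |PowerSeries.coeff n (discreteMittagLeffler β y) -
        PowerSeries.coeff n (discreteMittagLeffler β z)| ≤
      |y - z| * PowerSeries.coeff n (invOneSubRpow (1 + β)) := by
  have h : discreteMittagLeffler β y - discreteMittagLeffler β z =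
      PowerSeries.C (z - y) * (discreteMittagLeffler β y * fracResolvent β z) := by
    have hy' := mul_fracResolvent (β := β) hy
    have hz' := mul_fracResolvent (β := β) hz
    rw [map_sub]
    simp only [discreteMittagLeffler]
    linear_combination (invOneSubRpow (1 - β) * fracResolvent β z) * hy' -
      (invOneSubRpow (1 - β) * fracResolvent β y) * hz'
  have hnn := PowerSeries.coeff_mul_nonneg (coeff_discreteMittagLeffler_nonneg h0 h1 hy)
    (coeff_fracResolvent_nonneg h0 h1 hz) n
  have hle : PowerSeries.coeff n (discreteMittagLeffler β y * fracResolvent β z) ≤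
      PowerSeries.coeff n (invOneSubRpow (1 + β)) := by
    have e : invOneSubRpow (1 + β) - discreteMittagLeffler β y * fracResolvent β z =
        (invOneSubRpow 1 - discreteMittagLeffler β y) * invOneSubRpow β +
          discreteMittagLeffler β y * (invOneSubRpow β - fracResolvent β z) := by
      rw [invOneSubRpow_add]; ring
    have h2 := add_nonneg
      (PowerSeries.coeff_mul_nonneg (coeff_sub_discreteMittagLeffler_nonneg h0 h1 hy)
        (coeff_invOneSubRpow_nonneg h0) n)
      (PowerSeries.coeff_mul_nonneg (coeff_discreteMittagLeffler_nonneg h0 h1 hy)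
        (coeff_sub_fracResolvent_nonneg h0 h1 hz) n)
    rw [← map_add, ← e, map_sub] at h2
    linarith
  rw [← map_sub, h, PowerSeries.coeff_C_mul, abs_mul, abs_of_nonneg hnn, abs_sub_comm z y]
  gcongr

lemma discreteMittagLeffler_eq_sum_add (hy : 0 ≤ y) (K : ℕ) :
    discreteMittagLeffler β y =
      ∑ k ∈ Finset.range K, PowerSeries.C ((-y) ^ k) * invOneSubRpow (1 + β * k) +
        PowerSeries.C ((-y) ^ K) * (invOneSubRpow (β * K) * discreteMittagLeffler β y) := by
  induction K with
  | zero => simp [invOneSubRpow_zero]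
  | succ K ih =>
    have h := discreteMittagLeffler_eq_sub (β := β) hy
    rw [Finset.sum_range_succ]
    have e : β * ((K + 1 : ℕ) : ℝ) = β * K + β := by push_cast; ring
    rw [e, invOneSubRpow_add (β * K), invOneSubRpow_add 1, pow_succ, map_mul, map_neg]
    linear_combination ih + PowerSeries.C ((-y) ^ K) * invOneSubRpow (β * K) * h

lemma coeff_invOneSubRpow_one_add_le (n : ℕ) {a : ℝ} (ha : 0 ≤ a) :
    PowerSeries.coeff n (invOneSubRpow (1 + a)) ≤ (1 + a) ^ n := by
  induction n with
  | zero => simp [coeff_zero_invOneSubRpow]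
  | succ n ih =>
    rw [coeff_succ_invOneSubRpow, pow_succ]
    have : (1 + a + n) / ((n : ℝ) + 1) ≤ 1 + a := by
      rw [div_le_iff₀ (by positivity)]
      have : 0 ≤ a * n := by positivity
      linarith
    gcongr

lemma summable_pow_mul_coeff (h0 : 0 ≤ β) (h1 : β ≤ 1) (hy : 0 ≤ y) (hy1 : y < 1) (n : ℕ) :
    Summable fun k : ℕ => y ^ k * PowerSeries.coeff n (invOneSubRpow (1 + β * k)) := by
  have hp : Summable fun k : ℕ => (k : ℝ) ^ n * y ^ k :=
    summable_pow_mul_geometric_of_norm_lt_one n (by rwa [Real.norm_of_nonneg hy])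
  have hs : Summable fun k : ℕ => 2 ^ n * ((k : ℝ) ^ n * y ^ k) + 2 ^ n * y ^ k :=
    (hp.mul_left (2 ^ n)).add ((summable_geometric_of_lt_one hy hy1).mul_left (2 ^ n))
  refine Summable.of_nonneg_of_le (fun k => ?_) (fun k => ?_) hs
  · exact mul_nonneg (by positivity) (coeff_invOneSubRpow_nonneg (by positivity) n)
  · have hb : (1 + β * k : ℝ) ^ n ≤ 2 ^ n * ((k : ℝ) ^ n + 1) := by
      have hk : β * k ≤ k := mul_le_of_le_one_left (by positivity) h1
      rcases Nat.eq_zero_or_pos k with rfl | hk0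
      · have : (1 : ℝ) ≤ 2 ^ n := one_le_pow₀ (by norm_num)
        have : (0 : ℝ) ≤ 2 ^ n * ((0 : ℕ) : ℝ) ^ n := by positivity
        simp only [Nat.cast_zero, mul_zero, add_zero, one_pow] at *
        linarith
      · have h1k : (1 : ℝ) ≤ k := by exact_mod_cast hk0
        calc (1 + β * k : ℝ) ^ n ≤ (2 * k) ^ n := by gcongr; linarith
          _ = 2 ^ n * (k : ℝ) ^ n := mul_pow _ _ _
          _ ≤ _ := by gcongr; linarith
    calc y ^ k * PowerSeries.coeff n (invOneSubRpow (1 + β * k))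
        ≤ y ^ k * (2 ^ n * ((k : ℝ) ^ n + 1)) := by
          gcongr
          exact (coeff_invOneSubRpow_one_add_le n (by positivity)).trans hb
      _ = _ := by ring

lemma tsum_eq_coeff_discreteMittagLeffler (h0 : 0 ≤ β) (h1 : β ≤ 1) (hy : 0 ≤ y) (hy1 : y < 1)
    (n : ℕ) :
    ∑' k : ℕ, (-y) ^ k * PowerSeries.coeff n (invOneSubRpow (1 + β * k)) =
      PowerSeries.coeff n (discreteMittagLeffler β y) := by
  have hs := summable_pow_mul_coeff h0 h1 hy hy1 n
  have hs' : Summable fun k : ℕ =>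
      (-y) ^ k * PowerSeries.coeff n (invOneSubRpow (1 + β * k)) := by
    refine Summable.of_norm (hs.congr fun k => ?_)
    rw [norm_mul, norm_pow, norm_neg, Real.norm_of_nonneg hy,
      Real.norm_of_nonneg (coeff_invOneSubRpow_nonneg (by positivity) n)]
  refine tendsto_nhds_unique hs'.hasSum.tendsto_sum_nat ?_
  rw [tendsto_iff_norm_sub_tendsto_zero]
  refine squeeze_zero (fun _ => norm_nonneg _) (fun K => ?_) hs.tendsto_atTop_zero
  have h := congrArg (PowerSeries.coeff n) (discreteMittagLeffler_eq_sum_add (β := β) hy K)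
  simp only [map_add, map_sum, PowerSeries.coeff_C_mul] at h
  have hK : 0 ≤ β * K := by positivity
  have hnn := PowerSeries.coeff_mul_nonneg (coeff_invOneSubRpow_nonneg hK)
    (coeff_discreteMittagLeffler_nonneg h0 h1 hy) n
  have hle := PowerSeries.coeff_mul_nonneg (coeff_invOneSubRpow_nonneg hK)
    (coeff_sub_discreteMittagLeffler_nonneg h0 h1 hy) n
  rw [mul_sub, ← invOneSubRpow_add, map_sub, add_comm (β * (K : ℝ))] at hle
  rw [norm_sub_rev, h, add_sub_cancel_left, norm_mul, norm_pow, norm_neg, Real.norm_of_nonneg hy,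
    Real.norm_of_nonneg hnn]
  gcongr
  linarith

end

lemma coeff_invOneSubRpow_mul_rpow_neg_le {a : ℝ} (ha : 0 ≤ a) {N n : ℕ} (hN : 1 ≤ N) (hn : N ≤ n) :
    PowerSeries.coeff n (invOneSubRpow (1 + a)) * (n : ℝ) ^ (-a) ≤
      PowerSeries.coeff N (invOneSubRpow (1 + a)) * (N : ℝ) ^ (-a) := by
  induction n, hn using Nat.le_induction with
  | base => exact le_rfl
  | succ n hn ih =>
    refine le_trans ?_ ih
    have hn0 : (0 : ℝ) < n := by exact_mod_cast hN.trans hn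
    have hc := coeff_invOneSubRpow_nonneg (a := 1 + a) (by positivity) n
    rw [coeff_succ_invOneSubRpow, mul_assoc]
    refine mul_le_mul_of_nonneg_left ?_ hc
    have h1 : a / (n + 1) ≤ a * (Real.log (n + 1) - Real.log n) := by
      have h := Real.one_sub_inv_le_log_of_pos (x := ((n : ℝ) + 1) / n) (by positivity)
      rw [Real.log_div (by positivity) (by positivity)] at h
      have e : 1 - (((n : ℝ) + 1) / n)⁻¹ = 1 / (n + 1) := by field_simp; ring
      rw [e] at h
      calc a / (n + 1) = a * (1 / (n + 1)) := by ring
        _ ≤ _ := by gcongr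
    have h2 : (1 + a + n) / ((n : ℝ) + 1) ≤ Real.exp (a * (Real.log (n + 1) - Real.log n)) := by
      calc (1 + a + n) / ((n : ℝ) + 1) = a / (n + 1) + 1 := by field_simp; ring
        _ ≤ _ := (Real.add_one_le_exp _).trans (Real.exp_le_exp.2 h1)
    rw [Real.rpow_def_of_pos (by positivity), Real.rpow_def_of_pos hn0]
    push_cast
    calc (1 + a + n) / ((n : ℝ) + 1) * Real.exp (Real.log (n + 1) * -a)
        ≤ Real.exp (a * (Real.log (n + 1) - Real.log n)) * Real.exp (Real.log (n + 1) * -a) := by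
          gcongr
      _ = _ := by rw [← Real.exp_add]; ring_nf

lemma coeff_invOneSubRpow_eq_prod (a : ℝ) (n : ℕ) :
    PowerSeries.coeff n (invOneSubRpow a) =
      (∏ j ∈ Finset.range n, (a + j)) / (n.factorial : ℝ) := by
  induction n with
  | zero => simp [coeff_zero_invOneSubRpow]
  | succ n ih =>
    rw [coeff_succ_invOneSubRpow, ih, Finset.prod_range_succ, Nat.factorial_succ]
    push_cast
    have := Nat.factorial_ne_zero n
    field_simp

lemma tendsto_coeff_invOneSubRpow_mul_rpow_neg {a : ℝ} (ha : 0 ≤ a) :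
    Tendsto (fun n : ℕ => PowerSeries.coeff n (invOneSubRpow (1 + a)) * (n : ℝ) ^ (-a)) atTop
      (𝓝 (1 / Real.Gamma (1 + a))) := by
  have hΓ : Real.Gamma (1 + a) ≠ 0 := (Real.Gamma_pos_of_pos (by positivity)).ne'
  have h := (tendsto_natCast_div_add_atTop (𝕜 := ℝ) (1 + a)).div
    (Real.GammaSeq_tendsto_Gamma (1 + a)) hΓ
  refine h.congr' ?_
  filter_upwards [eventually_ge_atTop 1] with n hn
  have hn0 : (0 : ℝ) < n := by exact_mod_cast hn
  have hp : 0 < ∏ j ∈ Finset.range n, (1 + a + (j : ℝ)) :=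
    Finset.prod_pos fun j _ => by positivity
  have := Nat.factorial_ne_zero n
  have hna : (n : ℝ) ^ a ≠ 0 := by positivity
  simp only [Pi.div_apply]
  rw [coeff_invOneSubRpow_eq_prod, Real.GammaSeq, Finset.prod_range_succ, Real.rpow_add hn0,
    Real.rpow_one, Real.rpow_neg hn0.le]
  field_simp
  rw [add_comm]

section

variable {β x : ℝ}

lemma eventually_mul_rpow_neg_lt_one (h0 : 0 < β) (x : ℝ) :
    ∀ᶠ n : ℕ in atTop, x * (n : ℝ) ^ (-β) < 1 := by
  have h : Tendsto (fun n : ℕ => x * (n : ℝ) ^ (-β)) atTop (𝓝 (x * 0)) :=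
    ((tendsto_rpow_neg_atTop h0).comp tendsto_natCast_atTop_atTop).const_mul x
  exact h.eventually (gt_mem_nhds (by simp))

/-- The coefficients of `discreteMittagLeffler` at scale `x n ^ (-β)` converge to `E_β(-x)`. -/
lemma tendsto_coeff_discreteMittagLeffler (h0 : 0 < β) (h1 : β ≤ 1) (hx : 0 ≤ x) :
    Tendsto (fun n : ℕ =>
        PowerSeries.coeff n (discreteMittagLeffler β (x * (n : ℝ) ^ (-β)))) atTop
      (𝓝 (mittagLeffler β (-x))) := by
  obtain ⟨N, hN1, hNx⟩ :=
    ((eventually_ge_atTop 1).and (eventually_mul_rpow_neg_lt_one h0 x)).exists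
  have hpow : ∀ n k : ℕ, (x * (n : ℝ) ^ (-β)) ^ k = x ^ k * (n : ℝ) ^ (-(β * k)) := by
    intro n k
    rw [mul_pow, ← Real.rpow_natCast ((n : ℝ) ^ (-β)), ← Real.rpow_mul (by positivity), neg_mul]
  have hlim : Tendsto (fun n : ℕ => ∑' k : ℕ, (-x) ^ k *
      (PowerSeries.coeff n (invOneSubRpow (1 + β * k)) * (n : ℝ) ^ (-(β * k)))) atTop
      (𝓝 (mittagLeffler β (-x))) := by
    refine tendsto_tsum_of_dominated_convergence
      (summable_pow_mul_coeff h0.le h1 (by positivity) hNx N) (fun k => ?_) ?_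
    · have hk : 0 ≤ β * k := by positivity
      rw [div_eq_mul_one_div]
      exact (tendsto_coeff_invOneSubRpow_mul_rpow_neg hk).const_mul _
    · filter_upwards [eventually_ge_atTop N] with n hn k
      have hk : 0 ≤ β * k := by positivity
      have hc := coeff_invOneSubRpow_nonneg (a := 1 + β * k) (by positivity) n
      rw [norm_mul, norm_pow, norm_neg, Real.norm_of_nonneg hx, hpow,
        Real.norm_of_nonneg (by positivity), mul_assoc, mul_comm ((N : ℝ) ^ _)]
      exact mul_le_mul_of_nonneg_left (coeff_invOneSubRpow_mul_rpow_neg_le hk hN1 hn) (by positivity)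
  refine hlim.congr' ?_
  filter_upwards [eventually_mul_rpow_neg_lt_one h0 x] with n hn
  rw [← tsum_eq_coeff_discreteMittagLeffler h0.le h1 (by positivity) hn]
  refine tsum_congr fun k => ?_
  rw [neg_pow (x * _), hpow, neg_pow x]
  ring

lemma mittagLeffler_neg_nonneg (h0 : 0 < β) (h1 : β ≤ 1) (hx : 0 ≤ x) :
    0 ≤ mittagLeffler β (-x) :=
  ge_of_tendsto' (tendsto_coeff_discreteMittagLeffler h0 h1 hx) fun n =>
    coeff_discreteMittagLeffler_nonneg h0.le h1 (by positivity) n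

lemma mittagLeffler_neg_le_one (h0 : 0 < β) (h1 : β ≤ 1) (hx : 0 ≤ x) :
    mittagLeffler β (-x) ≤ 1 :=
  le_of_tendsto' (tendsto_coeff_discreteMittagLeffler h0 h1 hx) fun n =>
    coeff_discreteMittagLeffler_le_one h0.le h1 (by positivity) n

lemma abs_mittagLeffler_neg_sub_le (h0 : 0 < β) (h1 : β ≤ 1) (hx : 0 ≤ x) {z : ℝ} (hz : 0 ≤ z) :
    |mittagLeffler β (-x) - mittagLeffler β (-z)| ≤ |x - z| * (1 / Real.Gamma (1 + β)) := by
  refine le_of_tendsto_of_tendsto'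
    ((tendsto_coeff_discreteMittagLeffler h0 h1 hx).sub
      (tendsto_coeff_discreteMittagLeffler h0 h1 hz)).abs
    ((tendsto_coeff_invOneSubRpow_mul_rpow_neg h0.le).const_mul |x - z|) fun n => ?_
  refine (abs_coeff_discreteMittagLeffler_sub_le h0.le h1 (by positivity) (by positivity) n).trans
    (le_of_eq ?_)
  rw [← sub_mul, abs_mul, abs_of_nonneg (by positivity : (0 : ℝ) ≤ (n : ℝ) ^ (-β))]
  ring

/-- On the negative half-line `E_β` is Hölder continuous of every order `η ∈ [0, 1]`. -/
lemma sq_abs_mittagLeffler_neg_sub_le (h0 : 0 < β) (h1 : β ≤ 1) (hx : 0 ≤ x) {z η : ℝ}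
    (hz : 0 ≤ z) (hη0 : 0 ≤ η) (hη1 : η ≤ 1) :
    |mittagLeffler β (-x) - mittagLeffler β (-z)| ^ 2 ≤
      (|x - z| * (1 / Real.Gamma (1 + β))) ^ (2 * η) := by
  have hle : |mittagLeffler β (-x) - mittagLeffler β (-z)| ≤ 1 :=
    abs_sub_le_of_nonneg_of_le (mittagLeffler_neg_nonneg h0 h1 hx)
      (mittagLeffler_neg_le_one h0 h1 hx) (mittagLeffler_neg_nonneg h0 h1 hz)
      (mittagLeffler_neg_le_one h0 h1 hz)
  calc |mittagLeffler β (-x) - mittagLeffler β (-z)| ^ 2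
      = |mittagLeffler β (-x) - mittagLeffler β (-z)| ^ (2 : ℝ) := (Real.rpow_two _).symm
    _ ≤ |mittagLeffler β (-x) - mittagLeffler β (-z)| ^ (2 * η) :=
        Real.rpow_le_rpow_of_exponent_ge' (abs_nonneg _) hle (by positivity) (by linarith)
    _ ≤ _ := Real.rpow_le_rpow (abs_nonneg _) (abs_mittagLeffler_neg_sub_le h0 h1 hx hz)
        (by positivity)

lemma Real.abs_rpow_sub_rpow_le {t s : ℝ} (h0 : 0 ≤ β) (h1 : β ≤ 1) (ht : 0 ≤ t) (hs : 0 ≤ s) :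
    |t ^ β - s ^ β| ≤ |t - s| ^ β := by
  wlog h : s ≤ t generalizing t s
  · rw [abs_sub_comm, abs_sub_comm t]
    exact this hs ht (le_of_not_ge h)
  have h2 := Real.rpow_add_le_add_rpow (sub_nonneg.2 h) hs h0 h1
  rw [sub_add_cancel] at h2
  rw [abs_of_nonneg (sub_nonneg.2 (Real.rpow_le_rpow hs h h0)), abs_of_nonneg (sub_nonneg.2 h)]
  linarith

end

/-- Temporal mean-square Hölder continuity of the limit field of Theorem 3.2:
`∫_ℝ |G(λ)|² |E_β(-μt^β|λ|^α) - E_β(-μs^β|λ|^α)|² |λ|^{κ₀-1} dλ ≤ C |t-s|^{2ηβ}`. -/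
theorem limit_field_temporal_holder_classical
    (β μ α κ₀ η : ℝ) (hβ : β ∈ Set.Ioo (0 : ℝ) 1) (hμ : 0 < μ) (hα : 0 ≤ α)
    (hκ₀ : κ₀ ∈ Set.Ioo (0 : ℝ) 1) (hη : η ∈ Set.Ioc (0 : ℝ) 1)
    (G : ℝ → ℂ) (hGmeas : Measurable G)
    (hG : Integrable (fun l : ℝ => |l| ^ (κ₀ - 1) * ‖G l‖ ^ 2))
    (hGη : Integrable (fun l : ℝ => |l| ^ (2 * α * η + κ₀ - 1) * ‖G l‖ ^ 2)) :
    ∃ C : ℝ, 0 < C ∧ ∀ t s : ℝ, 0 < t → 0 < s →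
      ∫ l : ℝ, ‖G l‖ ^ 2 *
          |mittagLeffler β (-(μ * t ^ β * |l| ^ α)) -
            mittagLeffler β (-(μ * s ^ β * |l| ^ α))| ^ 2 * |l| ^ (κ₀ - 1) ≤
        C * |t - s| ^ (2 * η * β) := by
  obtain ⟨h0, hβ1⟩ := hβ
  obtain ⟨hη0, hη1⟩ := hη
  have h1 := hβ1.le
  have hΓ : 0 < 1 / Real.Gamma (1 + β) := by
    have := Real.Gamma_pos_of_pos (s := 1 + β) (by positivity)
    positivity
  set L := 1 / Real.Gamma (1 + β)
  have hI : 0 ≤ ∫ l : ℝ, |l| ^ (2 * α * η + κ₀ - 1) * ‖G l‖ ^ 2 :=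
    integral_nonneg fun l => by positivity
  refine ⟨(μ * L) ^ (2 * η) * (∫ l : ℝ, |l| ^ (2 * α * η + κ₀ - 1) * ‖G l‖ ^ 2) + 1,
    by positivity, fun t s ht hs => ?_⟩
  have hpt : ∀ l : ℝ, ‖G l‖ ^ 2 *
      |mittagLeffler β (-(μ * t ^ β * |l| ^ α)) -
        mittagLeffler β (-(μ * s ^ β * |l| ^ α))| ^ 2 * |l| ^ (κ₀ - 1) ≤
      (μ * L) ^ (2 * η) * |t - s| ^ (2 * η * β) *
        (|l| ^ (2 * α * η + κ₀ - 1) * ‖G l‖ ^ 2) := by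
    intro l
    rcases eq_or_ne l 0 with rfl | hl
    · rw [abs_zero, Real.zero_rpow (by linarith [hκ₀.2] : κ₀ - 1 ≠ 0), mul_zero]
      positivity
    have hl0 : 0 < |l| := abs_pos.2 hl
    have hE := sq_abs_mittagLeffler_neg_sub_le h0 h1 (x := μ * t ^ β * |l| ^ α)
      (z := μ * s ^ β * |l| ^ α) (by positivity) (by positivity) hη0.le hη1
    have hd : |μ * t ^ β * |l| ^ α - μ * s ^ β * |l| ^ α| * L ≤
        (μ * L) * |t - s| ^ β * |l| ^ α := by
      rw [← sub_mul, ← mul_sub, abs_mul, abs_mul, abs_of_pos hμ,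
        abs_of_nonneg (by positivity : 0 ≤ |l| ^ α)]
      have := Real.abs_rpow_sub_rpow_le h0.le h1 ht.le hs.le
      calc μ * |t ^ β - s ^ β| * |l| ^ α * L ≤ μ * |t - s| ^ β * |l| ^ α * L := by gcongr
        _ = _ := by ring
    have hE' := hE.trans (Real.rpow_le_rpow (by positivity) hd (by positivity))
    rw [Real.mul_rpow (by positivity) (by positivity),
      Real.mul_rpow (by positivity) (by positivity), ← Real.rpow_mul (by positivity),
      ← Real.rpow_mul (by positivity)] at hE'
    have e : |l| ^ (2 * α * η + κ₀ - 1) = |l| ^ (α * (2 * η)) * |l| ^ (κ₀ - 1) := by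
      rw [← Real.rpow_add hl0]; ring_nf
    rw [e, mul_comm (2 * η) β]
    calc _ ≤ ‖G l‖ ^ 2 * ((μ * L) ^ (2 * η) * |t - s| ^ (β * (2 * η)) * |l| ^ (α * (2 * η))) *
          |l| ^ (κ₀ - 1) := by gcongr
      _ = _ := by ring
  refine (integral_mono_of_nonneg (ae_of_all _ fun l => by positivity) (hGη.const_mul _)
    (ae_of_all _ hpt)).trans ?_
  rw [integral_const_mul, add_mul]
  have : 0 ≤ 1 * |t - s| ^ (2 * η * β) := by positivity
  linarith
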